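/- arXiv:1609.06452 — 3 statements merged into one kernel-verified Lean document; each statement's English description precedes it below -/
import Mathlib

section
/- Let p be a prime, K a field of characteristic p, and d, h, s natural numbers with h ≥ 1, d = h·p + s, s ≥ 1 and p not dividing d. Let σ be a permutation of {1,…,d} whose cycle type consists of exactly h cycles of length p, and let g denote the induced action of σ on the fully deleted permutation module V for S_d over K. Then for every natural number k, the dimension over K of the kernel of (g − id)^k equals h·min(k,p) + min(k,1)·(s−1); equivalently, g has Jordan form [J_p^h, J_1^{s−1}] on V. -/
/-- The sum-of-coordinates functional on `K^d`. -/
def sumFunctional (K : Type*) [Field K] (d : ℕ) : (Fin d → K) →ₗ[K] K where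
  toFun v := ∑ i, v i
  map_add' u v := by simp [Finset.sum_add_distrib]
  map_smul' c v := by simp [Finset.mul_sum]

/-- The zero-sum submodule `U` of the permutation module `K^d`. -/
def zeroSum (K : Type*) [Field K] (d : ℕ) : Submodule K (Fin d → K) :=
  LinearMap.ker (sumFunctional K d)

/-- The submodule `W` of constant vectors in `K^d`. -/
def constSub (K : Type*) [Field K] (d : ℕ) : Submodule K (Fin d → K) :=
  Submodule.span K {(fun _ => 1 : Fin d → K)}

/-- `U ∩ W`, viewed as a submodule of `U`. -/
def UW (K : Type*) [Field K] (d : ℕ) : Submodule K (zeroSum K d) :=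
  (zeroSum K d ⊓ constSub K d).comap (zeroSum K d).subtype

/-- The fully deleted permutation module `V = U/(U ∩ W)` for `S_d` over `K`. -/
abbrev deletedPermModule (K : Type*) [Field K] (d : ℕ) :=
  zeroSum K d ⧸ UW K d

/-- The linear action of a permutation `σ` on `K^d`, `v ↦ v ∘ σ`. -/
def permMap (K : Type*) [Field K] {d : ℕ} (σ : Equiv.Perm (Fin d)) :
    (Fin d → K) →ₗ[K] (Fin d → K) :=
  LinearMap.funLeft K K σ

lemma permMap_mem_zeroSum (K : Type*) [Field K] {d : ℕ} (σ : Equiv.Perm (Fin d))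
    {v : Fin d → K} (hv : v ∈ zeroSum K d) : permMap K σ v ∈ zeroSum K d := by
  simp only [zeroSum, LinearMap.mem_ker] at hv ⊢
  simpa [permMap, sumFunctional, LinearMap.funLeft, Equiv.sum_comp σ v] using hv

lemma permMap_mem_constSub (K : Type*) [Field K] {d : ℕ} (σ : Equiv.Perm (Fin d))
    {v : Fin d → K} (hv : v ∈ constSub K d) : permMap K σ v ∈ constSub K d := by
  rw [constSub, Submodule.mem_span_singleton] at hv ⊢
  obtain ⟨c, rfl⟩ := hv
  exact ⟨c, rfl⟩

/-- The endomorphism of the fully deleted permutation module induced by a permutation. -/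
def permEnd (K : Type*) [Field K] {d : ℕ} (σ : Equiv.Perm (Fin d)) :
    deletedPermModule K d →ₗ[K] deletedPermModule K d :=
  Submodule.mapQ (UW K d) (UW K d)
    ((permMap K σ).restrict (fun _ hv => permMap_mem_zeroSum K σ hv))
    (by
      rintro ⟨v, hvU⟩ hv
      simp only [UW, Submodule.mem_comap, Submodule.mem_inf, Submodule.coe_subtype,
        LinearMap.restrict_apply] at hv ⊢
      exact ⟨permMap_mem_zeroSum K σ hv.1, permMap_mem_constSub K σ hv.2⟩)

open Polynomial in
theorem sub_one_pow_pred_eq_geom_sum {p : ℕ} (hp : p.Prime) {K A : Type*} [Field K] [CharP K p]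
    [Ring A] [Algebra K A] (g : A) : (g - 1) ^ (p - 1) = ∑ i ∈ Finset.range p, g ^ i := by
  have := Fact.mk hp
  have key : (X - 1 : K[X]) ^ (p - 1) = ∑ i ∈ Finset.range p, X ^ i := by
    have hX : (X - 1 : K[X]) ≠ 0 := by simpa using X_sub_C_ne_zero (1 : K)
    apply mul_right_cancel₀ hX
    rw [geom_sum_mul, ← pow_succ, Nat.sub_add_cancel hp.one_le, sub_pow_char, one_pow]
  simpa using congrArg (aeval g) key

section Linear

variable {K V : Type*} [Field K] [AddCommGroup V] [Module K V] [FiniteDimensional K V]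

open Module LinearMap

theorem finrank_range_pow_succ_add (T : V →ₗ[K] V) (k : ℕ) :
    finrank K (range (T ^ (k + 1))) + finrank K (ker T ⊓ range (T ^ k) : Submodule K V) =
      finrank K (range (T ^ k)) := by
  rw [← finrank_range_add_finrank_ker (T.domRestrict (range (T ^ k)))]
  congr 1
  · rw [range_domRestrict, ← range_comp, pow_succ', Module.End.mul_eq_comp]
  · rw [ker_domRestrict]
    rw [inf_comm, ← Submodule.map_comap_subtype]
    exact (Submodule.equivMapOfInjective (range (T ^ k)).subtype
      (Submodule.subtype_injective _) _).finrank_eq.symm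

/-- A nilpotent endomorphism whose kernel and top power are as large as those of
`[J_p^h, J_1^t]` has that Jordan form. -/
theorem finrank_ker_pow_of_le {p h t : ℕ} (hp : 1 ≤ p) (T : V →ₗ[K] V) (hT : T ^ p = 0)
    (hV : finrank K V = h * p + t) (hker : h + t ≤ finrank K (ker T))
    (hrange : h ≤ finrank K (range (T ^ (p - 1)))) (k : ℕ) :
    finrank K (ker (T ^ k)) = h * min k p + min k 1 * t := by
  have step := finrank_range_pow_succ_add T
  have hb : ∀ j < p, h ≤ finrank K (ker T ⊓ range (T ^ j) : Submodule K V) := by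
    intro j hj
    refine hrange.trans (Submodule.finrank_mono (le_inf ?_ ?_))
    · rintro _ ⟨v, rfl⟩
      rw [mem_ker, ← Module.End.mul_apply, ← pow_succ', Nat.sub_add_cancel hp, hT,
        LinearMap.zero_apply]
    · rintro _ ⟨v, rfl⟩
      refine ⟨(T ^ (p - 1 - j)) v, ?_⟩
      rw [← Module.End.mul_apply, ← pow_add]
      congr 2
      omega
  have lower : ∀ j ≤ p, h * j ≤ finrank K (range (T ^ (p - j))) := by
    intro j
    induction j with
    | zero => simp
    | succ j ih =>
      intro hj
      have h1 := step (p - (j + 1))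
      have h2 := hb (p - (j + 1)) (by omega)
      rw [show p - (j + 1) + 1 = p - j by omega] at h1
      have := ih (by omega)
      rw [mul_add]
      omega
  have upper : ∀ j < p, finrank K (range (T ^ (j + 1))) + h * j ≤ finrank K (range T) := by
    intro j
    induction j with
    | zero => intro _; rw [zero_add, pow_one, mul_zero, add_zero]
    | succ j ih =>
      intro hj
      have h1 := step (j + 1)
      have h2 := hb (j + 1) hj
      have := ih (by omega)
      rw [mul_add]
      omega
  have hrn := finrank_range_add_finrank_ker T
  obtain rfl | hk := Nat.eq_zero_or_pos k
  · simp [Module.End.one_eq_id]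
  rcases le_total k p with hkp | hkp
  · have h1 := lower (p - k) (by omega)
    have h2 := upper (k - 1) (by omega)
    rw [Nat.sub_sub_self hkp] at h1
    rw [Nat.sub_add_cancel hk] at h2
    have h3 := finrank_range_add_finrank_ker (T ^ k)
    rw [min_eq_left hkp, min_eq_right hk]
    obtain ⟨m, rfl⟩ := Nat.exists_eq_add_of_le hkp
    obtain ⟨n, rfl⟩ := Nat.exists_eq_add_of_le hk
    simp only [Nat.add_sub_cancel_left, mul_add, one_mul] at *
    omega
  · have h0 : T ^ k = 0 := by
      rw [← Nat.add_sub_cancel' hkp, pow_add, hT, zero_mul]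
    rw [h0, ker_zero, finrank_top, hV, min_eq_right hkp, min_eq_right hk, one_mul]

end Linear

open LinearMap in
theorem linearIndependent_of_dual_points {K X I : Type*} [Field K] [DecidableEq I]
    (f : I → X → K) (r : I → X) (hfr : ∀ i j, f i (r j) = if i = j then 1 else 0) :
    LinearIndependent K f := by
  refine LinearIndependent.of_comp (LinearMap.funLeft K K r) ?_
  have : LinearMap.funLeft K K r ∘ f = fun i => Pi.single i 1 := by
    ext i j
    simp [funLeft_apply, hfr, Pi.single_apply, eq_comm]
  rw [this]
  exact Pi.linearIndependent_single_one I K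

namespace Equiv.Perm

theorem pow_eq_one_of_cycleType_eq_replicate {α : Type*} [Fintype α] [DecidableEq α]
    {σ : Perm α} {h p : ℕ} (hσ : σ.cycleType = Multiset.replicate h p) : σ ^ p = 1 := by
  rw [← orderOf_dvd_iff_pow_eq_one, ← lcm_cycleType, hσ, Multiset.lcm_dvd]
  intro b hb
  rw [Multiset.eq_of_mem_replicate hb]

theorem apply_eq_self_of_pow_apply_eq_self {α : Type*} {σ : Perm α} {p i : ℕ} (hp : p.Prime)
    (hσ : σ ^ p = 1) (h0 : 0 < i) (hi : i < p) {x : α} (hx : (σ ^ i) x = x) : σ x = x := by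
  have h1 : Function.IsPeriodicPt σ i x := by
    rwa [Function.IsPeriodicPt, Function.IsFixedPt, iterate_eq_pow]
  have h2 : Function.IsPeriodicPt σ p x := by
    rw [Function.IsPeriodicPt, Function.IsFixedPt, iterate_eq_pow, hσ, one_apply]
  have h3 := h1.gcd h2
  rwa [Nat.Coprime.gcd_eq_one (Nat.coprime_of_lt_prime h0.ne' hi hp).symm] at h3

/-- One point from each nontrivial cycle. -/
theorem exists_cycle_representatives {α : Type*} [Fintype α] [DecidableEq α] (σ : Perm α) :
    ∃ r : σ.cycleFactorsFinset → α, (∀ c, σ (r c) ≠ r c) ∧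
      ∀ c c', σ.SameCycle (r c) (r c') → c = c' := by
  have hne : ∀ c : σ.cycleFactorsFinset, ∃ x, x ∈ c.1.support := fun c =>
    Finset.nonempty_iff_ne_empty.2 fun h =>
      (mem_cycleFactorsFinset_iff.1 c.2).1.ne_one (support_eq_empty_iff.1 h)
  choose r hr using hne
  refine ⟨r, fun c => mem_support.1 (mem_cycleFactorsFinset_support_le c.2 (hr c)), ?_⟩
  intro c c' hcc
  apply Subtype.ext
  rw [cycle_is_cycleOf (hr c) c.2, cycle_is_cycleOf (hr c') c'.2, hcc.cycleOf_eq]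

end Equiv.Perm

section PermutationModule

open Module LinearMap

variable {K : Type*} [Field K] {d : ℕ}

theorem permMap_pow_apply (σ : Equiv.Perm (Fin d)) (n : ℕ) (v : Fin d → K) (x : Fin d) :
    (permMap K σ ^ n) v x = v ((σ ^ n) x) := by
  induction n generalizing x with
  | zero => simp
  | succ n ih =>
    rw [pow_succ', Module.End.mul_apply, permMap, funLeft_apply, ← permMap, ih, pow_succ,
      Equiv.Perm.mul_apply]

theorem permMap_sub_id_pow_prime {p : ℕ} (hp : p.Prime) [CharP K p] {σ : Equiv.Perm (Fin d)}
    (hσ : σ ^ p = 1) : (permMap K σ - LinearMap.id) ^ p = 0 := by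
  have h1 : (permMap K σ - LinearMap.id) ^ (p - 1) * (permMap K σ - LinearMap.id) =
      permMap K σ ^ p - 1 := by
    rw [← Module.End.one_eq_id, sub_one_pow_pred_eq_geom_sum (K := K) hp, geom_sum_mul]
  rw [← pow_succ, Nat.sub_add_cancel hp.one_le] at h1
  rw [h1, sub_eq_zero]
  refine LinearMap.ext fun v => funext fun x => ?_
  rw [permMap_pow_apply, hσ, Equiv.Perm.one_apply, Module.End.one_apply]

theorem permMap_sub_id_pow_pred_apply {p : ℕ} (hp : p.Prime) [CharP K p]
    (σ : Equiv.Perm (Fin d)) (v : Fin d → K) (x : Fin d) :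
    ((permMap K σ - LinearMap.id) ^ (p - 1) : Module.End K (Fin d → K)) v x =
      ∑ i ∈ Finset.range p, v ((σ ^ i) x) := by
  rw [← Module.End.one_eq_id, sub_one_pow_pred_eq_geom_sum (K := K) hp, LinearMap.sum_apply,
    Finset.sum_apply]
  simp only [permMap_pow_apply]

/-- The Jordan form on the full permutation module. -/
theorem finrank_ker_permMap_sub_id_pow {p : ℕ} (hp : p.Prime) [CharP K p] {h s : ℕ}
    (hd : d = h * p + s) {σ : Equiv.Perm (Fin d)} (hσ : σ.cycleType = Multiset.replicate h p)
    (k : ℕ) :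
    finrank K (ker ((permMap K σ - LinearMap.id) ^ k)) = h * min k p + min k 1 * s := by
  set T := permMap K σ - LinearMap.id with hTdef
  have hσp := Equiv.Perm.pow_eq_one_of_cycleType_eq_replicate hσ
  have hTp : T ^ p = 0 := permMap_sub_id_pow_prime hp hσp
  obtain ⟨r, hr, hrinj⟩ := σ.exists_cycle_representatives
  have hcard : Fintype.card σ.cycleFactorsFinset = h := by
    have := congrArg Multiset.card hσ
    rw [Multiset.card_replicate, Equiv.Perm.cycleType_def, Multiset.card_map] at this
    rw [Fintype.card_coe]
    exact this
  have hfix : Fintype.card {x // σ x = x} = s := by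
    have h1 := σ.sum_cycleType
    rw [hσ, Multiset.sum_replicate, smul_eq_mul] at h1
    have h2 := Fintype.card_subtype_compl (fun x => σ x = x)
    rw [Fintype.card_fin] at h2
    have h3 : Fintype.card {x // ¬ σ x = x} = σ.support.card := by
      rw [Fintype.card_subtype]; rfl
    have h4 := Fintype.card_subtype_le (fun x => σ x = x)
    rw [Fintype.card_fin] at h4
    omega
  let f : σ.cycleFactorsFinset ⊕ {x // σ x = x} → Fin d → K :=
    Sum.elim (fun c => (T ^ (p - 1)) (Pi.single (r c) 1)) (fun x => Pi.single x.1 1)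
  have hf : LinearIndependent K f := by
    refine linearIndependent_of_dual_points f (Sum.elim r Subtype.val) ?_
    rintro (c | x) (c' | y)
    · simp only [f, Sum.elim_inl, hTdef, permMap_sub_id_pow_pred_apply hp, Sum.inl.injEq]
      rw [Finset.sum_eq_single_of_mem 0 (Finset.mem_range.2 hp.pos)]
      · by_cases hcc : c = c'
        · rw [if_pos hcc, hcc, pow_zero, Equiv.Perm.one_apply, Pi.single_eq_same]
        · rw [if_neg hcc, pow_zero, Equiv.Perm.one_apply, Pi.single_eq_of_ne]
          intro he
          exact hcc (hrinj c c' (by rw [he]))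
      · intro i hi hi0
        apply Pi.single_eq_of_ne
        intro he
        have hc : c' = c := hrinj c' c ⟨i, by rw [zpow_natCast, he]⟩
        subst hc
        exact hr _ (Equiv.Perm.apply_eq_self_of_pow_apply_eq_self hp hσp
          (Nat.pos_of_ne_zero hi0) (Finset.mem_range.1 hi) he)
    · simp only [f, Sum.elim_inl, Sum.elim_inr, hTdef, permMap_sub_id_pow_pred_apply hp,
        reduceCtorEq, if_false]
      refine Finset.sum_eq_zero fun i _ => Pi.single_eq_of_ne ?_ _
      rw [Equiv.Perm.pow_apply_eq_self_of_apply_eq_self y.2]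
      intro he
      exact hr c (he ▸ y.2)
    · simp only [f, Sum.elim_inl, Sum.elim_inr, reduceCtorEq, if_false]
      refine Pi.single_eq_of_ne ?_ _
      intro he
      exact hr c' (he ▸ x.2)
    · simp [f, Pi.single_apply, Subtype.ext_iff, eq_comm]
  refine finrank_ker_pow_of_le hp.one_le T hTp (by simpa using hd) ?_ ?_ k
  · have hmem : Submodule.span K (Set.range f) ≤ ker T := by
      rw [Submodule.span_le]
      rintro _ ⟨c | x, rfl⟩
      · change T ((T ^ (p - 1)) _) = 0
        rw [← Module.End.mul_apply, ← pow_succ', Nat.sub_add_cancel hp.one_le, hTp,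
          LinearMap.zero_apply]
      · change T (Pi.single x.1 1) = 0
        ext y
        have : σ y = x.1 ↔ y = x.1 := by
          conv_lhs => rw [← x.2]
          exact σ.injective.eq_iff
        simp [hTdef, permMap, funLeft_apply, Pi.single_apply, this]
    have := Submodule.finrank_mono hmem
    rwa [finrank_span_eq_card hf, Fintype.card_sum, hcard, hfix] at this
  · have hmem : Submodule.span K (Set.range (f ∘ Sum.inl)) ≤ range (T ^ (p - 1)) := by
      rw [Submodule.span_le]
      rintro _ ⟨c, rfl⟩
      exact ⟨_, rfl⟩
    have := Submodule.finrank_mono hmem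
    rwa [finrank_span_eq_card (hf.comp _ Sum.inl_injective), hcard] at this

/-- The projection of the permutation module onto `V` along the constant vectors. -/
def deletedProj (K : Type*) [Field K] (d : ℕ) (hd : (d : K) ≠ 0) :
    (Fin d → K) →ₗ[K] deletedPermModule K d :=
  (UW K d).mkQ ∘ₗ LinearMap.codRestrict (zeroSum K d)
    (LinearMap.id - ((d : K)⁻¹ • sumFunctional K d).smulRight (fun _ => (1 : K)))
    (fun v => by
      simp [zeroSum, sumFunctional, Finset.sum_sub_distrib, mul_inv_cancel_left₀ hd])

theorem zeroSum_inf_constSub (hd : (d : K) ≠ 0) : zeroSum K d ⊓ constSub K d = ⊥ := by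
  rw [eq_bot_iff]
  rintro v ⟨hU, hW⟩
  obtain ⟨c, rfl⟩ := Submodule.mem_span_singleton.1 hW
  have : (d : K) * c = 0 := by simpa [zeroSum, sumFunctional, mul_comm, or_comm] using hU
  rw [(mul_eq_zero.1 this).resolve_left hd, zero_smul]
  exact Submodule.zero_mem _

theorem UW_eq_bot (hd : (d : K) ≠ 0) : UW K d = ⊥ := by
  rw [UW, zeroSum_inf_constSub hd]
  exact ker_eq_bot.2 (Submodule.subtype_injective _)

theorem deletedProj_apply_of_mem (hd : (d : K) ≠ 0) (u : zeroSum K d) :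
    deletedProj K d hd u = (UW K d).mkQ u := by
  have hu : sumFunctional K d u = 0 := u.2
  refine congrArg (UW K d).mkQ (Subtype.ext ?_)
  ext i
  change (u : Fin d → K) i - (d : K)⁻¹ * sumFunctional K d u * 1 = (u : Fin d → K) i
  rw [hu, mul_zero, zero_mul, sub_zero]

theorem deletedProj_const (hd : (d : K) ≠ 0) {v : Fin d → K} (hv : v ∈ constSub K d) :
    deletedProj K d hd v = 0 := by
  obtain ⟨c, rfl⟩ := Submodule.mem_span_singleton.1 hv
  refine (congrArg (UW K d).mkQ (Subtype.ext ?_)).trans (map_zero _)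
  ext i
  simp [sumFunctional, inv_mul_cancel₀ hd]

theorem ker_deletedProj (hd : (d : K) ≠ 0) : ker (deletedProj K d hd) = constSub K d := by
  refine le_antisymm (fun v hv => ?_) fun v hv => deletedProj_const hd hv
  have h1 : (LinearMap.codRestrict (zeroSum K d) _ _ : (Fin d → K) →ₗ[K] _) v ∈ UW K d :=
    (Submodule.Quotient.mk_eq_zero _).1 hv
  rw [UW_eq_bot hd, Submodule.mem_bot] at h1
  have h2 := congrArg Subtype.val h1
  refine Submodule.mem_span_singleton.2 ⟨(d : K)⁻¹ * sumFunctional K d v, ?_⟩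
  exact (sub_eq_zero.1 h2).symm

theorem deletedProj_surjective (hd : (d : K) ≠ 0) :
    Function.Surjective (deletedProj K d hd) := by
  intro q
  obtain ⟨u, rfl⟩ := Submodule.mkQ_surjective _ q
  exact ⟨u, deletedProj_apply_of_mem hd u⟩

theorem permEnd_comp_deletedProj (hd : (d : K) ≠ 0) (σ : Equiv.Perm (Fin d)) :
    permEnd K σ ∘ₗ deletedProj K d hd = deletedProj K d hd ∘ₗ permMap K σ := by
  refine LinearMap.ext fun v => ?_
  refine congrArg (UW K d).mkQ (Subtype.ext ?_)
  ext i
  simp [sumFunctional, permMap, funLeft_apply, Equiv.sum_comp σ v]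

theorem finrank_constSub (hd : (d : K) ≠ 0) : finrank K (constSub K d) = 1 := by
  refine finrank_span_singleton fun h0 => ?_
  obtain ⟨n, rfl⟩ : ∃ n, d = n + 1 := Nat.exists_eq_succ_of_ne_zero (by rintro rfl; simp at hd)
  exact one_ne_zero (congrFun h0 0)

/-- Passing to `V` removes one trivial Jordan block. -/
theorem finrank_ker_permEnd_sub_id_pow_succ (hd : (d : K) ≠ 0) (σ : Equiv.Perm (Fin d)) (k : ℕ) :
    finrank K (ker ((permEnd K σ - LinearMap.id) ^ (k + 1))) + 1 =
      finrank K (ker ((permMap K σ - LinearMap.id) ^ (k + 1))) := by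
  set P := deletedProj K d hd
  set S := permEnd K σ - LinearMap.id
  set T := permMap K σ - LinearMap.id
  have hST : S ∘ₗ P = P ∘ₗ T := by
    rw [LinearMap.sub_comp, LinearMap.comp_sub, permEnd_comp_deletedProj, LinearMap.id_comp,
      LinearMap.comp_id]
  have hpow : (S ^ (k + 1)) ∘ₗ P = P ∘ₗ (T ^ (k + 1)) := by
    induction k + 1 with
    | zero => rfl
    | succ n ih =>
      rw [pow_succ, pow_succ, Module.End.mul_eq_comp, Module.End.mul_eq_comp, LinearMap.comp_assoc,
        hST, ← LinearMap.comp_assoc, ih, LinearMap.comp_assoc]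
  have hker : ker (P ∘ₗ (T ^ (k + 1))) = ker (T ^ (k + 1)) := by
    refine le_antisymm (fun v hv => ?_) (ker_le_ker_comp _ _)
    have hW : (T ^ (k + 1)) v ∈ constSub K d := by
      rw [← ker_deletedProj hd]
      exact hv
    have hU : (T ^ (k + 1)) v ∈ zeroSum K d := by
      rw [pow_succ', Module.End.mul_apply]
      simp [T, zeroSum, sumFunctional, permMap, funLeft_apply, Finset.sum_sub_distrib,
        Equiv.sum_comp σ]
    have := Submodule.mem_inf.2 ⟨hU, hW⟩
    rwa [zeroSum_inf_constSub hd] at this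
  have hP : range P = ⊤ := range_eq_top.2 (deletedProj_surjective hd)
  have h1 := finrank_range_add_finrank_ker P
  have h2 := finrank_range_add_finrank_ker (S ^ (k + 1))
  have h3 := finrank_range_add_finrank_ker ((S ^ (k + 1)) ∘ₗ P)
  rw [hP, finrank_top, ker_deletedProj, finrank_constSub hd] at h1
  rw [range_comp_of_range_eq_top _ hP, hpow, hker] at h3
  omega

end PermutationModule

/-- Lemma 3.2(i): if `char K = p`, `d = hp + s` with `s ≥ 1` and `p ∤ d`, and `σ ∈ S_d`
has cycle type consisting of `h` cycles of length `p`, then the induced endomorphism `g`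
of the fully deleted permutation module has Jordan form `[J_p^h, J_1^{s-1}]`, i.e.
`dim ker (g - 1)^k = h·min(k,p) + min(k,1)·(s-1)` for all `k`. -/
theorem stmt_12 (p : ℕ) (hp : p.Prime) (K : Type*) [Field K] [CharP K p]
    (d h s : ℕ) (hh : 1 ≤ h) (hd : d = h * p + s) (hs : 1 ≤ s) (hpd : ¬ p ∣ d)
    (σ : Equiv.Perm (Fin d)) (hσ : σ.cycleType = Multiset.replicate h p) (k : ℕ) :
    Module.finrank K (LinearMap.ker ((permEnd K σ - LinearMap.id) ^ k)) =
      h * min k p + min k 1 * (s - 1) := by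
  have hdK : (d : K) ≠ 0 := fun h0 => hpd ((CharP.cast_eq_zero_iff K p d).1 h0)
  obtain _ | k := k
  · simp [Module.End.one_eq_id]
  · have h1 := finrank_ker_permEnd_sub_id_pow_succ hdK σ k
    rw [finrank_ker_permMap_sub_id_pow hp hd hσ, min_eq_right (Nat.le_add_left 1 k)] at h1
    rw [min_eq_right (Nat.le_add_left 1 k)]
    omega
end

section
/- Let p be a prime, K a field of characteristic p, and d, h, s natural numbers with h ≥ 1, d = h·p + s, s ≥ 1 and p dividing d (so in fact s ≥ 2). Let σ be a permutation of {1,…,d} whose cycle type consists of exactly h cycles of length p, and let g denote the induced action of σ on the fully deleted permutation module V for S_d over K. Then for every natural number k, the dimension over K of the kernel of (g − id)^k equals h·min(k,p) + min(k,1)·(s−2); equivalently, g has Jordan form [J_p^h, J_1^{s−2}] on V. -/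
open Module

/-- The permutation of `(ι × ZMod p) ⊕ R` which shifts the second coordinate of `ι × ZMod p`
by one and fixes `R` pointwise. -/
def blockShift (ι R : Type*) (p : ℕ) : Equiv.Perm ((ι × ZMod p) ⊕ R) :=
  Equiv.sumCongr (Equiv.prodCongr (Equiv.refl ι) (Equiv.addRight 1)) (Equiv.refl R)

section blockShift

variable {ι R : Type*} {p : ℕ}

@[simp]
lemma blockShift_inl (i : ι) (x : ZMod p) :
    blockShift ι R p (Sum.inl (i, x)) = Sum.inl (i, x + 1) := rfl

@[simp]
lemma blockShift_inr (r : R) : blockShift ι R p (Sum.inr r) = Sum.inr r := rfl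

lemma blockShift_pow_inl (k : ℕ) (i : ι) (x : ZMod p) :
    (blockShift ι R p ^ k) (Sum.inl (i, x)) = Sum.inl (i, x + k) := by
  induction k with
  | zero => simp
  | succ k ih => simp [pow_succ', ih, add_assoc]

lemma blockShift_pow_inr (k : ℕ) (r : R) :
    (blockShift ι R p ^ k) (Sum.inr r) = Sum.inr r := by
  induction k with
  | zero => simp
  | succ k ih => simp [pow_succ', ih]

lemma blockShift_pow_self : blockShift ι R p ^ p = 1 := by
  ext1 x
  rcases x with ⟨i, x⟩ | r
  · simp [blockShift_pow_inl]
  · simp [blockShift_pow_inr]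

variable [Fintype ι] [Fintype R] [Fact p.Prime]

lemma exists_equiv_blockShift {α : Type*} [Fintype α] [DecidableEq α] (σ : Equiv.Perm α)
    (hσ : σ.cycleType = Multiset.replicate (Fintype.card ι) p)
    (hcard : Fintype.card α = Fintype.card ι * p + Fintype.card R) :
    ∃ e : (ι × ZMod p) ⊕ R ≃ α, ∀ x, e (blockShift ι R p x) = σ (e x) := by
  classical
  have hp : p.Prime := Fact.out
  let e₀ : (ι × ZMod p) ⊕ R ≃ α := Fintype.equivOfCardEq (by simp [hcard, ZMod.card])
  let τ : Equiv.Perm α := e₀.permCongrHom (blockShift ι R p)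
  have hτ : ∀ x, τ (e₀ x) = e₀ (blockShift ι R p x) := fun x => by simp [τ]
  have hpow : τ ^ p = 1 := by
    rw [← map_pow, blockShift_pow_self, map_one]
  have hsupp : τ.support = Finset.univ.map (Function.Embedding.inl.trans e₀.toEmbedding) := by
    ext y
    obtain ⟨x, rfl⟩ := e₀.surjective y
    rcases x with ⟨i, x⟩ | r <;> simp [hτ]
  have hrep := Equiv.Perm.cycleType_of_pow_prime_eq_one hpow
  have hsum := τ.sum_cycleType
  rw [hrep, hsupp] at hsum
  simp only [Multiset.sum_replicate, smul_eq_mul, Finset.card_map, Finset.card_univ,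
    Fintype.card_prod, ZMod.card] at hsum
  rw [Nat.eq_of_mul_eq_mul_right hp.pos hsum, ← hσ] at hrep
  obtain ⟨c, hc⟩ := isConj_iff.mp (Equiv.Perm.isConj_of_cycleType_eq hrep)
  refine ⟨e₀.trans c, fun x => ?_⟩
  simp [← hc, hτ]

end blockShift

section linearAlgebra

variable {K : Type*} [Field K] {V W : Type*} [AddCommGroup V] [Module K V]
  [AddCommGroup W] [Module K W]

lemma LinearEquiv.finrank_ker_pow_eq (e : V ≃ₗ[K] W) (f : End K V) (g : End K W)
    (h : ∀ v, e (f v) = g (e v)) (k : ℕ) :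
    finrank K (LinearMap.ker (f ^ k)) = finrank K (LinearMap.ker (g ^ k)) := by
  have hk : ∀ v, e ((f ^ k) v) = (g ^ k) (e v) := by
    induction k with
    | zero => simp
    | succ k ih =>
      intro v
      rw [pow_succ, pow_succ, Module.End.mul_apply, Module.End.mul_apply, ih, h]
  rw [← LinearEquiv.finrank_map_eq e]
  suffices H : (LinearMap.ker (f ^ k)).map (e : V →ₗ[K] W) = LinearMap.ker (g ^ k) by rw [H]
  ext w
  obtain ⟨v, rfl⟩ := e.surjective w
  simp [← hk]

lemma finrank_ker_pow_succ_le [FiniteDimensional K V] (f : End K V) (k : ℕ) :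
    finrank K (LinearMap.ker (f ^ (k + 1))) ≤
      finrank K (LinearMap.ker (f ^ k)) + finrank K (LinearMap.ker f) := by
  let φ : LinearMap.ker (f ^ (k + 1)) →ₗ[K] LinearMap.ker f :=
    (f ^ k).restrict (fun v hv => by
      rwa [LinearMap.mem_ker, ← Module.End.mul_apply, ← pow_succ'])
  have h := φ.finrank_range_add_finrank_ker
  have h₁ : finrank K (LinearMap.range φ) ≤ finrank K (LinearMap.ker f) :=
    Submodule.finrank_le _
  have h₂ : finrank K (LinearMap.ker φ) ≤ finrank K (LinearMap.ker (f ^ k)) := by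
    rw [← Submodule.finrank_map_subtype_eq]
    refine Submodule.finrank_mono ?_
    rintro _ ⟨v, hv, rfl⟩
    simpa [φ, Subtype.ext_iff] using hv
  omega

/-- If `f` is nilpotent of order at most `dim V` and has kernel of dimension at most one, then it
is a single Jordan block. -/
lemma finrank_ker_pow_eq_min [FiniteDimensional K V] (f : End K V) {n : ℕ}
    (hn : finrank K V = n) (hf : f ^ n = 0) (hker : finrank K (LinearMap.ker f) ≤ 1) (k : ℕ) :
    finrank K (LinearMap.ker (f ^ k)) = min k n := by
  have hstep : ∀ j i, finrank K (LinearMap.ker (f ^ (i + j))) ≤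
      finrank K (LinearMap.ker (f ^ i)) + j := by
    intro j i
    induction j with
    | zero => simp
    | succ j ih =>
      have := finrank_ker_pow_succ_le f (i + j)
      rw [← add_assoc]
      omega
  have htop : ∀ m, n ≤ m → finrank K (LinearMap.ker (f ^ m)) = n := by
    intro m hm
    rw [pow_eq_zero_of_le hm hf, LinearMap.ker_zero, finrank_top, hn]
  rcases le_total k n with hk | hk
  · have h₁ := hstep k 0
    have h₂ := hstep (n - k) k
    rw [Nat.add_sub_cancel' hk, htop n le_rfl] at h₂
    have h₀ : finrank K (LinearMap.ker (f ^ 0)) = 0 := by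
      rw [pow_zero, Module.End.one_eq_id, LinearMap.ker_id, finrank_bot]
    rw [zero_add, h₀] at h₁
    omega
  · rw [htop k hk, min_eq_right hk]

end linearAlgebra

section permutationModule

variable (K : Type*) [Field K]

lemma finrank_ker_shift_sub_one_pow (p : ℕ) [Fact p.Prime] [CharP K p] (k : ℕ) :
    finrank K (LinearMap.ker
      ((LinearMap.funLeft K K (Equiv.addRight (1 : ZMod p)) - 1 : End K (ZMod p → K)) ^ k)) =
      min k p := by
  have hp : p.Prime := Fact.out
  have : CharP (End K (ZMod p → K)) p :=
    charP_of_injective_algebraMap (algebraMap K (End K (ZMod p → K))).injective p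
  refine finrank_ker_pow_eq_min _ (by simp [ZMod.card]) ?_ ?_ k
  · rw [sub_pow_char_of_commute p (Commute.one_right _), one_pow, sub_eq_zero]
    have h : ∀ (n : ℕ) (v : ZMod p → K) (x : ZMod p),
        ((LinearMap.funLeft K K (Equiv.addRight (1 : ZMod p)) : End K (ZMod p → K)) ^ n) v x =
          v (x + n) := by
      intro n
      induction n with
      | zero => simp
      | succ n ih =>
        intro v x
        rw [pow_succ, Module.End.mul_apply, ih]
        simp [LinearMap.funLeft_apply, add_assoc]
    refine LinearMap.ext fun v => funext fun x => ?_
    rw [h]; simp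
  · have hinj : LinearMap.ker ((LinearMap.proj 0 : (ZMod p → K) →ₗ[K] K).domRestrict
        (LinearMap.ker (LinearMap.funLeft K K (Equiv.addRight (1 : ZMod p)) - 1))) = ⊥ := by
      refine LinearMap.ker_eq_bot'.mpr ?_
      rintro ⟨v, hv⟩ hv₀
      have hshift : ∀ x, v (x + 1) = v x := fun x => by
        simpa [sub_eq_zero, LinearMap.funLeft_apply] using congrFun hv x
      have hnat : ∀ n : ℕ, v n = v 0 := by
        intro n
        induction n with
        | zero => simp
        | succ n ih => rw [Nat.cast_succ, hshift, ih]
      ext x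
      have := hnat x.val
      rw [ZMod.natCast_zmod_val] at this
      exact this.trans hv₀
    simpa using LinearMap.finrank_le_finrank_of_injective (LinearMap.ker_eq_bot.mp hinj)

variable {ι R : Type*} {p : ℕ}

lemma blockShift_sub_one_pow_inl (k : ℕ) (w : (ι × ZMod p) ⊕ R → K) (i : ι) (x : ZMod p) :
    ((LinearMap.funLeft K K (blockShift ι R p) - 1 : End K ((ι × ZMod p) ⊕ R → K)) ^ k) w
        (Sum.inl (i, x)) =
      ((LinearMap.funLeft K K (Equiv.addRight (1 : ZMod p)) - 1 : End K (ZMod p → K)) ^ k)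
        (fun y => w (Sum.inl (i, y))) x := by
  induction k generalizing w with
  | zero => simp
  | succ k ih =>
    rw [pow_succ, pow_succ, Module.End.mul_apply, Module.End.mul_apply, ih]
    rfl

lemma blockShift_sub_one_pow_succ_inr (k : ℕ) (w : (ι × ZMod p) ⊕ R → K) (r : R) :
    ((LinearMap.funLeft K K (blockShift ι R p) - 1 : End K ((ι × ZMod p) ⊕ R → K)) ^ (k + 1)) w
        (Sum.inr r) = 0 := by
  rw [pow_succ', Module.End.mul_apply]
  simp [LinearMap.funLeft_apply]

/-- The kernel of a positive power of `blockShift - 1` splits along the blocks. -/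
def kerBlockShiftEquiv (ι R : Type*) (p k : ℕ) :
    LinearMap.ker ((LinearMap.funLeft K K (blockShift ι R p) - 1 :
        End K ((ι × ZMod p) ⊕ R → K)) ^ (k + 1)) ≃ₗ[K]
      (ι → LinearMap.ker ((LinearMap.funLeft K K (Equiv.addRight (1 : ZMod p)) - 1 :
        End K (ZMod p → K)) ^ (k + 1))) × (R → K) where
  toFun w := (fun i => ⟨fun x => w.1 (Sum.inl (i, x)), by
    ext x
    rw [← blockShift_sub_one_pow_inl K (R := R) (k + 1) w.1 i x, LinearMap.mem_ker.mp w.2]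
    rfl⟩, fun r => w.1 (Sum.inr r))
  map_add' _ _ := rfl
  map_smul' _ _ := rfl
  invFun f := ⟨Sum.elim (fun ix => (f.1 ix.1).1 ix.2) f.2, by
    ext x
    rcases x with ⟨i, x⟩ | r
    · rw [blockShift_sub_one_pow_inl K]
      exact congrFun (f.1 i).2 x
    · exact blockShift_sub_one_pow_succ_inr K k _ r⟩
  left_inv w := by
    ext x
    rcases x with ⟨i, x⟩ | r <;> rfl
  right_inv _ := rfl

lemma finrank_ker_blockShift_sub_one_pow [Fintype ι] [Fintype R] [Fact p.Prime] [CharP K p]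
    (k : ℕ) :
    finrank K (LinearMap.ker
      ((LinearMap.funLeft K K (blockShift ι R p) - 1 : End K ((ι × ZMod p) ⊕ R → K)) ^ k)) =
      Fintype.card ι * min k p + min k 1 * Fintype.card R := by
  cases k with
  | zero => simp [Module.End.one_eq_id]
  | succ k =>
    rw [(kerBlockShiftEquiv K ι R p k).finrank_eq, finrank_prod, finrank_pi_fintype,
      finrank_fintype_fun_eq_card]
    simp only [finrank_ker_shift_sub_one_pow]
    simp

end permutationModule

section deletedPermModule

variable {K : Type*} [Field K] {d : ℕ}

lemma mem_zeroSum {v : Fin d → K} : v ∈ zeroSum K d ↔ ∑ i, v i = 0 := Iff.rfl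

/-- The map `U → K^Y` sending `v` to `y ↦ v (f y) - v b`. -/
def differenceMap (K : Type*) [Field K] {Y : Type*} (f : Y → Fin d) (b : Fin d) :
    zeroSum K d →ₗ[K] (Y → K) where
  toFun v y := v.1 (f y) - v.1 b
  map_add' u v := by
    ext y
    simp only [Submodule.coe_add, Pi.add_apply]
    ring
  map_smul' c v := by
    ext y
    simp [mul_sub]

variable {Y : Type*} [Fintype Y] (e : Y ⊕ Bool ≃ Fin d)

lemma differenceMap_surjective :
    Function.Surjective (differenceMap K (e ∘ Sum.inl) (e (Sum.inr true))) := by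
  intro w
  refine ⟨⟨fun i => Sum.elim w (fun c => if c then 0 else -∑ y, w y) (e.symm i), ?_⟩, ?_⟩
  · rw [mem_zeroSum, ← e.sum_comp]
    simp
  · ext y
    simp [differenceMap]

lemma ker_differenceMap (hd : (d : K) = 0) :
    LinearMap.ker (differenceMap K (e ∘ Sum.inl) (e (Sum.inr true))) = UW K d := by
  ext ⟨v, hv⟩
  simp only [UW, Submodule.mem_comap, Submodule.mem_inf, Submodule.coe_subtype, hv, true_and,
    constSub, Submodule.mem_span_singleton, LinearMap.mem_ker]
  constructor
  · intro h
    have hinl : ∀ y, v (e (Sum.inl y)) = v (e (Sum.inr true)) := fun y =>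
      sub_eq_zero.mp (congrFun h y)
    have hcard : (Fintype.card Y : K) + 2 = 0 := by
      have := Fintype.card_congr e
      rw [Fintype.card_sum, Fintype.card_bool, Fintype.card_fin] at this
      rw [← hd, ← this]
      push_cast
      rfl
    rw [mem_zeroSum, ← e.sum_comp] at hv
    simp only [Fintype.sum_sum_type, hinl, Finset.sum_const, Finset.card_univ, nsmul_eq_mul,
      Fintype.sum_bool] at hv
    refine ⟨v (e (Sum.inr true)), ?_⟩
    ext i
    obtain ⟨x, rfl⟩ := e.surjective i
    rcases x with y | c
    · simp [hinl]
    · cases c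
      · simp only [Pi.smul_apply, smul_eq_mul, mul_one]
        linear_combination v (e (Sum.inr true)) * hcard - hv
      · simp
  · rintro ⟨c, rfl⟩
    ext y
    simp [differenceMap]

/-- If `d = 0` in `K`, the fully deleted permutation module is the space of functions on the
index set with two points removed. -/
noncomputable def deletedPermModuleEquiv (hd : (d : K) = 0) :
    deletedPermModule K d ≃ₗ[K] (Y → K) :=
  (Submodule.quotEquivOfEq _ _ (ker_differenceMap e hd).symm).trans
    ((differenceMap K (e ∘ Sum.inl) (e (Sum.inr true))).quotKerEquivOfSurjective
      (differenceMap_surjective e))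

lemma deletedPermModuleEquiv_permEnd (hd : (d : K) = 0) (σ : Equiv.Perm (Fin d))
    (τ : Equiv.Perm Y) (hτ : ∀ y, σ (e (Sum.inl y)) = e (Sum.inl (τ y)))
    (hfix : σ (e (Sum.inr true)) = e (Sum.inr true)) (v : deletedPermModule K d) :
    deletedPermModuleEquiv e hd (permEnd K σ v) =
      LinearMap.funLeft K K τ (deletedPermModuleEquiv e hd v) := by
  obtain ⟨v, rfl⟩ := Submodule.Quotient.mk_surjective _ v
  ext y
  change v.1 (σ (e (Sum.inl y))) - v.1 (σ (e (Sum.inr true))) =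
    v.1 (e (Sum.inl (τ y))) - v.1 (e (Sum.inr true))
  rw [hτ, hfix]

end deletedPermModule

/-- Lemma 3.2(ii): if `char K = p`, `d = hp + s` with `s ≥ 1` and `p ∣ d` (so `s ≥ 2`),
and `σ ∈ S_d` has cycle type consisting of `h` cycles of length `p`, then the induced
endomorphism `g` of the fully deleted permutation module has Jordan form
`[J_p^h, J_1^{s-2}]`, i.e. `dim ker (g - 1)^k = h·min(k,p) + min(k,1)·(s-2)`. -/
theorem stmt_13 (p : ℕ) (hp : p.Prime) (K : Type*) [Field K] [CharP K p]
    (d h s : ℕ) (hh : 1 ≤ h) (hd : d = h * p + s) (hs : 1 ≤ s) (hpd : p ∣ d)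
    (σ : Equiv.Perm (Fin d)) (hσ : σ.cycleType = Multiset.replicate h p) (k : ℕ) :
    Module.finrank K (LinearMap.ker ((permEnd K σ - LinearMap.id) ^ k)) =
      h * min k p + min k 1 * (s - 2) := by
  have : Fact p.Prime := ⟨hp⟩
  have hps : p ∣ s := (Nat.dvd_add_right (dvd_mul_left p h)).mp (hd ▸ hpd)
  have hs₂ : 2 ≤ s := hp.two_le.trans (Nat.le_of_dvd hs hps)
  have hdK : (d : K) = 0 := (CharP.cast_eq_zero_iff K p d).mpr hpd
  obtain ⟨e, he⟩ := exists_equiv_blockShift (ι := Fin h) (R := Fin (s - 2) ⊕ Bool) (p := p) σ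
    (by simpa using hσ) (by simp; omega)
  let e' : ((Fin h × ZMod p) ⊕ Fin (s - 2)) ⊕ Bool ≃ Fin d :=
    (Equiv.sumAssoc _ _ _).trans e
  have hcomm := deletedPermModuleEquiv_permEnd e' hdK σ (blockShift (Fin h) (Fin (s - 2)) p)
    (by rintro (⟨i, x⟩ | r) <;> simp [e', ← he]) (by simp [e', ← he])
  rw [(deletedPermModuleEquiv e' hdK).finrank_ker_pow_eq (permEnd K σ - LinearMap.id)
    (LinearMap.funLeft K K (blockShift (Fin h) (Fin (s - 2)) p) - 1)
    (fun v => by simp [hcomm]), finrank_ker_blockShift_sub_one_pow]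
  simp
end

section
/- Let K be a field, let V1 and V2 be finite-dimensional K-vector spaces with dim V2 ≥ 2, and let f : V1 → V1 and g : V2 → V2 be diagonalizable K-linear endomorphisms. Suppose that f has an eigenvalue whose eigenspace has dimension at least 2, and that the induced endomorphism f ⊗ g of V1 ⊗_K V2 is not a scalar multiple of the identity. Then f ⊗ g has an eigenvalue ν ≠ 1 whose eigenspace in V1 ⊗_K V2 has dimension at least 2. -/
open Module in
theorem finrank_eigenspace_mul_le_finrank_eigenspace_map {K V W : Type*} [Field K]
    [AddCommGroup V] [Module K V] [AddCommGroup W] [Module K W]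
    [FiniteDimensional K V] [FiniteDimensional K W] (f : End K V) (g : End K W) (a b : K) :
    finrank K (f.eigenspace a) * finrank K (g.eigenspace b) ≤
      finrank K (End.eigenspace (TensorProduct.map f g) (a * b)) := by
  have hinj : Function.Injective
      (TensorProduct.map (f.eigenspace a).subtype (g.eigenspace b).subtype) :=
    TensorProduct.map_injective_of_flat_flat _ _
      (Submodule.subtype_injective _) (Submodule.subtype_injective _)
  rw [← finrank_tensorProduct, ← LinearMap.finrank_range_of_inj hinj]
  refine Submodule.finrank_mono ?_
  rintro _ ⟨x, rfl⟩
  induction x with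
  | zero => simp
  | add x y hx hy => rw [map_add]; exact add_mem hx hy
  | tmul x y =>
    rw [End.mem_eigenspace_iff]
    simp only [TensorProduct.map_tmul, Submodule.subtype_apply]
    rw [End.mem_eigenspace_iff.mp x.2, End.mem_eigenspace_iff.mp y.2,
      TensorProduct.smul_tmul_smul]

open Module in
theorem eq_smul_id_of_iSup_eigenspace_eq_top {K V : Type*} [Field K]
    [AddCommGroup V] [Module K V] (f : End K V) (c : K)
    (hf : (⨆ μ : K, f.eigenspace μ) = ⊤) (h : ∀ μ, f.eigenspace μ ≠ ⊥ → μ = c) :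
    f = c • LinearMap.id := by
  have htop : f.eigenspace c = ⊤ := by
    rw [eq_top_iff, ← hf]
    refine iSup_le fun μ => ?_
    by_cases hμ : f.eigenspace μ = ⊥
    · simp [hμ]
    · rw [h μ hμ]
  ext v
  exact End.mem_eigenspace_iff.mp (htop ▸ Submodule.mem_top)

/-- Lemma 5.2: if `f` and `g` are diagonalizable endomorphisms of finite-dimensional
`K`-vector spaces `V₁` and `V₂` with `dim V₂ ≥ 2`, `f` has a repeated eigenvalue, and
`f ⊗ g` is not a scalar multiple of the identity, then `f ⊗ g` has a nontrivial
repeated eigenvalue, i.e. some eigenvalue `ν ≠ 1` with eigenspace of dimension `≥ 2`. -/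
theorem stmt_16 {K : Type*} [Field K] {V1 V2 : Type*} [AddCommGroup V1] [Module K V1]
    [AddCommGroup V2] [Module K V2] [FiniteDimensional K V1] [FiniteDimensional K V2]
    (hV2 : 2 ≤ Module.finrank K V2)
    (f : Module.End K V1) (g : Module.End K V2)
    (hf : (⨆ μ : K, Module.End.eigenspace f μ) = ⊤)
    (hg : (⨆ μ : K, Module.End.eigenspace g μ) = ⊤)
    (hrep : ∃ μ : K, 2 ≤ Module.finrank K (Module.End.eigenspace f μ))
    (hns : ∀ c : K, TensorProduct.map f g ≠ c • LinearMap.id) :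
    ∃ ν : K, ν ≠ 1 ∧
      2 ≤ Module.finrank K (Module.End.eigenspace (TensorProduct.map f g) ν) := by
  obtain ⟨μ, hμ⟩ := hrep
  by_contra! H
  have eq_one (a b : K) (h : 2 ≤ Module.finrank K (f.eigenspace a) *
      Module.finrank K (g.eigenspace b)) : a * b = 1 := by
    by_contra hab
    have := finrank_eigenspace_mul_le_finrank_eigenspace_map f g a b
    have := H _ hab
    lia
  have hg' : g = μ⁻¹ • LinearMap.id := by
    refine eq_smul_id_of_iSup_eigenspace_eq_top g _ hg fun b hb => ?_
    refine eq_inv_of_mul_eq_one_right (eq_one μ b ?_)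
    exact hμ.trans (Nat.le_mul_of_pos_right _ (Submodule.one_le_finrank_iff.mpr hb))
  have htop : g.eigenspace μ⁻¹ = ⊤ := by
    ext v
    simp [hg']
  have hf' : f = μ • LinearMap.id := by
    refine eq_smul_id_of_iSup_eigenspace_eq_top f _ hf fun a ha => ?_
    rw [← inv_inv μ]
    refine eq_inv_of_mul_eq_one_left (eq_one a μ⁻¹ ?_)
    rw [htop, finrank_top]
    exact hV2.trans (Nat.le_mul_of_pos_left _ (Submodule.one_le_finrank_iff.mpr ha))
  apply hns (μ * μ⁻¹)
  rw [hf', hg', TensorProduct.map_smul_left, TensorProduct.map_smul_right,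
    TensorProduct.map_id, smul_smul]
end
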